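/- arXiv:2005.13500 — 4 statements merged into one kernel-verified Lean document; each statement's English description precedes it below -/
import Mathlib

section
/- Let γ = (γ⁽¹⁾, γ⁽²⁾) : ℝ → ℝ × (0,∞) be a smooth 1-periodic immersed curve and let F_γ : ℝ² → ℝ³ be the associated torus of revolution, F_γ(u,v) = (γ⁽¹⁾(u), γ⁽²⁾(u)cos(2πv), γ⁽²⁾(u)sin(2πv)). Then the Euclidean diameter of the image F_γ(ℝ²) ⊆ ℝ³ satisfies diam(F_γ(ℝ²)) ≤ (1/2)·L_E(γ) + 2·sup_{x∈[0,1]} γ⁽²⁾(x), where L_E(γ) = ∫₀¹ |γ'(x)| dx is the Euclidean length of γ. -/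
open Real

/-- The length of a `C¹` planar curve over an interval dominates the increment of its first
coordinate. -/
lemma abs_sub_le_integral_speed {f g : ℝ → ℝ} (hf : ContDiff ℝ 1 f) (hg : ContDiff ℝ 1 g)
    {a b : ℝ} (hab : a ≤ b) :
    |f b - f a| ≤ ∫ x in a..b, Real.sqrt ((deriv f x) ^ 2 + (deriv g x) ^ 2) := by
  have hf' : Continuous (deriv f) := hf.continuous_deriv le_rfl
  have hg' : Continuous (deriv g) := hg.continuous_deriv le_rfl
  rw [← intervalIntegral.integral_deriv_eq_sub
    (fun x _ => (hf.differentiable one_ne_zero).differentiableAt)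
    (hf'.intervalIntegrable a b), ← Real.norm_eq_abs]
  refine intervalIntegral.norm_integral_le_of_norm_le hab (Filter.Eventually.of_forall ?_)
    ((by fun_prop : Continuous _).intervalIntegrable a b)
  intro x _
  exact Real.abs_le_sqrt (by nlinarith [sq_nonneg (deriv g x)])

/-- Two values of the first coordinate of a closed planar curve differ by at most half the
length of the curve. -/
lemma abs_sub_le_half_integral_speed {f g : ℝ → ℝ} (hf : ContDiff ℝ 1 f) (hg : ContDiff ℝ 1 g)
    (hclosed : f 1 = f 0) {u v : ℝ} (hu : u ∈ Set.Icc (0 : ℝ) 1) (hv : v ∈ Set.Icc (0 : ℝ) 1) :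
    |f u - f v| ≤
      (1 / 2) * ∫ x in (0 : ℝ)..1, Real.sqrt ((deriv f x) ^ 2 + (deriv g x) ^ 2) := by
  wlog huv : u ≤ v generalizing u v
  · rw [abs_sub_comm]
    exact this hv hu (le_of_not_ge huv)
  have hf' : Continuous (deriv f) := hf.continuous_deriv le_rfl
  have hg' : Continuous (deriv g) := hg.continuous_deriv le_rfl
  have hint : ∀ a b : ℝ, IntervalIntegrable
      (fun x => Real.sqrt ((deriv f x) ^ 2 + (deriv g x) ^ 2)) MeasureTheory.volume a b :=
    fun a b => (by fun_prop : Continuous _).intervalIntegrable a b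
  have h₁ := abs_sub_le_integral_speed hf hg hu.1
  have h₂ := abs_sub_le_integral_speed hf hg huv
  have h₃ := abs_sub_le_integral_speed hf hg hv.2
  rw [← intervalIntegral.integral_add_adjacent_intervals (hint 0 u) (hint u 1),
    ← intervalIntegral.integral_add_adjacent_intervals (hint u v) (hint v 1)]
  rw [hclosed] at h₃
  rw [abs_le] at h₁ h₂ h₃ ⊢
  constructor <;> linarith [h₁.1, h₁.2, h₂.1, h₂.2, h₃.1, h₃.2]

/-- The distance between two points given in cylindrical coordinates. -/
lemma dist_cylindrical_le {a b r s : ℝ} (hr : 0 ≤ r) (hs : 0 ≤ s) (α β : ℝ) :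
    dist ((WithLp.equiv 2 (Fin 3 → ℝ)).symm ![a, r * Real.cos α, r * Real.sin α]
        : EuclideanSpace ℝ (Fin 3))
      ((WithLp.equiv 2 (Fin 3 → ℝ)).symm ![b, s * Real.cos β, s * Real.sin β]) ≤
      |a - b| + r + s := by
  rw [EuclideanSpace.dist_eq, Real.sqrt_le_iff]
  refine ⟨by positivity, ?_⟩
  simp only [Fin.sum_univ_three, WithLp.equiv_symm_apply, Real.dist_eq, sq_abs, Matrix.cons_val]
  have hcos : 0 ≤ r * s * (1 + Real.cos (α - β)) :=
    mul_nonneg (mul_nonneg hr hs) (by linarith [Real.neg_one_le_cos (α - β)])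
  rw [Real.cos_sub] at hcos
  calc (a - b) ^ 2 + (r * Real.cos α - s * Real.cos β) ^ 2
        + (r * Real.sin α - s * Real.sin β) ^ 2
      = (a - b) ^ 2 + r ^ 2 * (Real.sin α ^ 2 + Real.cos α ^ 2)
        + s ^ 2 * (Real.sin β ^ 2 + Real.cos β ^ 2)
        - 2 * (r * s * (Real.cos α * Real.cos β + Real.sin α * Real.sin β)) := by ring
    _ ≤ |a - b| ^ 2 + (r + s) ^ 2 := by
      rw [Real.sin_sq_add_cos_sq, Real.sin_sq_add_cos_sq, sq_abs]
      linarith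
    _ ≤ (|a - b| + r + s) ^ 2 := by
      nlinarith [mul_nonneg (abs_nonneg (a - b)) (add_nonneg hr hs)]

/-- A `1`-periodic function takes the same value at a real number and at its fractional part. -/
lemma Function.Periodic.apply_fract {f : ℝ → ℝ} (hf : Function.Periodic f 1) (x : ℝ) :
    f (Int.fract x) = f x := by
  simpa only [Int.fract, zsmul_eq_mul, mul_one] using hf.sub_zsmul_eq (x := x) ⌊x⌋

/-- For a smooth 1-periodic immersed curve `γ = (γ₁, γ₂)` in the hyperbolic half-plane,
the (Euclidean) diameter of the image of the associated torus of revolution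
`F_γ(u,v) = (γ₁ u, γ₂ u · cos(2πv), γ₂ u · sin(2πv))` is bounded by
`(1/2)·L_E(γ) + 2·sup_{x ∈ [0,1]} γ₂ x`. -/
theorem stmt_2
    (γ₁ γ₂ : ℝ → ℝ)
    (hγ₁ : ContDiff ℝ (⊤ : ℕ∞) γ₁) (hγ₂ : ContDiff ℝ (⊤ : ℕ∞) γ₂)
    (hpos : ∀ x, 0 < γ₂ x)
    (hper₁ : ∀ x, γ₁ (x + 1) = γ₁ x) (hper₂ : ∀ x, γ₂ (x + 1) = γ₂ x)
    (himm : ∀ x, (deriv γ₁ x, deriv γ₂ x) ≠ (0, 0)) :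
    Metric.diam (Set.range (fun p : ℝ × ℝ =>
        ((WithLp.equiv 2 (Fin 3 → ℝ)).symm
          ![γ₁ p.1, γ₂ p.1 * Real.cos (2 * π * p.2), γ₂ p.1 * Real.sin (2 * π * p.2)]
          : EuclideanSpace ℝ (Fin 3)))) ≤
      (1 / 2) * (∫ x in (0:ℝ)..1, Real.sqrt ((deriv γ₁ x) ^ 2 + (deriv γ₂ x) ^ 2)) +
        2 * sSup (γ₂ '' Set.Icc (0:ℝ) 1) := by
  have hf : ContDiff ℝ 1 γ₁ := hγ₁.of_le (mod_cast le_top)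
  have hg : ContDiff ℝ 1 γ₂ := hγ₂.of_le (mod_cast le_top)
  have hfract : ∀ x : ℝ, Int.fract x ∈ Set.Icc (0 : ℝ) 1 :=
    fun x => ⟨Int.fract_nonneg x, (Int.fract_lt_one x).le⟩
  have hbdd : BddAbove (γ₂ '' Set.Icc (0 : ℝ) 1) :=
    (isCompact_Icc.image hg.continuous).bddAbove
  have hle : ∀ x, γ₂ x ≤ sSup (γ₂ '' Set.Icc (0 : ℝ) 1) := fun x =>
    le_csSup hbdd ⟨Int.fract x, hfract x, Function.Periodic.apply_fract hper₂ x⟩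
  have hclosed : γ₁ 1 = γ₁ 0 := by simpa using hper₁ 0
  have hdist : ∀ u v, |γ₁ u - γ₁ v| ≤
      (1 / 2) * ∫ x in (0:ℝ)..1, Real.sqrt ((deriv γ₁ x) ^ 2 + (deriv γ₂ x) ^ 2) := by
    intro u v
    rw [← Function.Periodic.apply_fract hper₁ u, ← Function.Periodic.apply_fract hper₁ v]
    exact abs_sub_le_half_integral_speed hf hg hclosed (hfract u) (hfract v)
  apply Metric.diam_le_of_forall_dist_le
  · linarith [(abs_nonneg _).trans (hdist 0 0), hpos 0, hle 0]
  · rintro _ ⟨p, rfl⟩ _ ⟨q, rfl⟩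
    refine (dist_cylindrical_le (hpos p.1).le (hpos q.1).le _ _).trans ?_
    linarith [hdist p.1 q.1, hle p.1, hle q.1]
end

section
/- Let γ = (γ⁽¹⁾, γ⁽²⁾) : ℝ → ℝ × (0,∞) be a smooth 1-periodic curve parametrized with constant Euclidean speed |γ'(u)| = L > 0 for all u. Then ∫₀¹ [ ((γ⁽¹⁾)''(u)(γ⁽²⁾)'(u) − (γ⁽²⁾)''(u)(γ⁽¹⁾)'(u))/L³ + (γ⁽¹⁾)'(u)/(L·γ⁽²⁾(u)) ] · (γ⁽¹⁾)'(u) · γ⁽²⁾(u) du = L. (Geometrically, this expresses that the mean curvature vector of the torus of revolution with profile curve γ, integrated in the third coordinate direction over half of the surface, equals −2L.) -/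
open Real

/-- For a smooth 1-periodic curve `γ = (γ₁, γ₂) : ℝ → ℝ × (0,∞)` parametrized with
constant Euclidean speed `|γ'(u)| = L > 0`, one has
`∫₀¹ [ (γ₁'' γ₂' − γ₂'' γ₁')/L³ + γ₁'/(L γ₂) ] · γ₁' · γ₂ du = L`. -/
theorem stmt_4
    (γ₁ γ₂ : ℝ → ℝ)
    (hγ₁ : ContDiff ℝ (⊤ : ℕ∞) γ₁) (hγ₂ : ContDiff ℝ (⊤ : ℕ∞) γ₂)
    (hpos : ∀ u, 0 < γ₂ u)
    (hper₁ : ∀ u, γ₁ (u + 1) = γ₁ u) (hper₂ : ∀ u, γ₂ (u + 1) = γ₂ u)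
    (L : ℝ) (hLpos : 0 < L)
    (hspeed : ∀ u, (deriv γ₁ u) ^ 2 + (deriv γ₂ u) ^ 2 = L ^ 2) :
    (∫ u in (0:ℝ)..1,
      ((deriv (deriv γ₁) u * deriv γ₂ u - deriv (deriv γ₂) u * deriv γ₁ u) / L ^ 3 +
        deriv γ₁ u / (L * γ₂ u)) * deriv γ₁ u * γ₂ u) = L := by
  have hd₁ : ContDiff ℝ (⊤ : ℕ∞) (deriv γ₁) := (contDiff_infty_iff_deriv.1 hγ₁).2
  have hd₂ : ContDiff ℝ (⊤ : ℕ∞) (deriv γ₂) := (contDiff_infty_iff_deriv.1 hγ₂).2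
  have hdd₂ : Continuous (deriv (deriv γ₂)) := (contDiff_infty_iff_deriv.1 hd₂).2.continuous
  have h₂ : ∀ u, HasDerivAt γ₂ (deriv γ₂ u) u := fun u =>
    ((contDiff_infty_iff_deriv.1 hγ₂).1 u).hasDerivAt
  have h₁' : ∀ u, HasDerivAt (deriv γ₁) (deriv (deriv γ₁) u) u := fun u =>
    ((contDiff_infty_iff_deriv.1 hd₁).1 u).hasDerivAt
  have h₂' : ∀ u, HasDerivAt (deriv γ₂) (deriv (deriv γ₂) u) u := fun u =>
    ((contDiff_infty_iff_deriv.1 hd₂).1 u).hasDerivAt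
  have horth : ∀ u, deriv γ₁ u * deriv (deriv γ₁) u + deriv γ₂ u * deriv (deriv γ₂) u = 0 := by
    intro u
    have h := ((h₁' u).fun_pow 2).fun_add ((h₂' u).fun_pow 2)
    simp only [hspeed] at h
    have h0 := h.unique (hasDerivAt_const u (L ^ 2))
    norm_num at h0
    linarith
  have hL := hLpos.ne'
  have hintegrand : ∀ u,
      ((deriv (deriv γ₁) u * deriv γ₂ u - deriv (deriv γ₂) u * deriv γ₁ u) / L ^ 3 +
        deriv γ₁ u / (L * γ₂ u)) * deriv γ₁ u * γ₂ u =
      L - (deriv γ₂ u * deriv γ₂ u + γ₂ u * deriv (deriv γ₂) u) / L := by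
    intro u
    have hy := (hpos u).ne'
    field_simp
    linear_combination γ₂ u * deriv γ₂ u * horth u +
      (L ^ 2 - γ₂ u * deriv (deriv γ₂) u) * hspeed u
  have hprim : ∀ u, HasDerivAt (fun u => L * u - γ₂ u * deriv γ₂ u / L)
      (L - (deriv γ₂ u * deriv γ₂ u + γ₂ u * deriv (deriv γ₂) u) / L) u := by
    intro u
    simpa using ((hasDerivAt_id u).const_mul L).fun_sub (((h₂ u).fun_mul (h₂' u)).div_const L)
  have hc : Continuous γ₂ := hγ₂.continuous
  have hc' : Continuous (deriv γ₂) := hd₂.continuous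
  have hend : γ₂ 1 = γ₂ 0 := by simpa using hper₂ 0
  have hend' : deriv γ₂ 1 = deriv γ₂ 0 := by
    have h := deriv_comp_add_const γ₂ 1 0
    simp only [hper₂, zero_add] at h
    exact h.symm
  simp only [hintegrand]
  rw [intervalIntegral.integral_eq_sub_of_hasDerivAt (fun u _ => hprim u)
    (Continuous.intervalIntegrable (by fun_prop) 0 1), hend, hend']
  ring
end

section
/- Let γ = (γ⁽¹⁾, γ⁽²⁾) : ℝ → ℝ × (0,∞) be a smooth 1-periodic immersed curve. Then the Euclidean length L_E(γ) = ∫₀¹ |γ'(u)| du satisfies L_E(γ)² ≤ μ(γ) · W(γ), where μ(γ) = 2π ∫₀¹ γ⁽²⁾(u)|γ'(u)| du is the surface area of the torus of revolution with profile curve γ and W(γ) = (π/2) ∫₀¹ ( κ_euc[γ](u) − (γ⁽¹⁾)'(u)/(|γ'(u)|·γ⁽²⁾(u)) )² · γ⁽²⁾(u)|γ'(u)| du is its Willmore energy, with κ_euc[γ](u) = ((γ⁽¹⁾)'(u)(γ⁽²⁾)''(u) − (γ⁽²⁾)'(u)(γ⁽¹⁾)''(u))/|γ'(u)|³ the Euclidean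 scalar curvature of γ. -/
open Real

/-- A quadratic upper bound on `2 t L` valid for all real `t` forces `L² ≤ A B`. -/
lemma sq_le_mul_of_forall_quadratic {A B L : ℝ}
    (h : ∀ t : ℝ, 2 * t * L ≤ t ^ 2 * A + B) : L ^ 2 ≤ B * A := by
  have hd : discrim A (-2 * L) B ≤ 0 :=
    discrim_le_zero fun t => by nlinarith [h t]
  rw [discrim] at hd
  nlinarith

/-- Along a plane curve `(x, y)` with speed `s`, the derivative of `y` times the sine of the
tangent angle. -/
lemma hasDerivAt_mul_deriv_div_speed {x y : ℝ → ℝ}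
    (hx : ContDiff ℝ (⊤ : ℕ∞) x) (hy : ContDiff ℝ (⊤ : ℕ∞) y) (u : ℝ)
    (hu : 0 < (deriv x u) ^ 2 + (deriv y u) ^ 2) :
    HasDerivAt (fun u => y u * (deriv y u / √((deriv x u) ^ 2 + (deriv y u) ^ 2)))
      (deriv y u ^ 2 / √((deriv x u) ^ 2 + (deriv y u) ^ 2) +
        y u * (deriv x u * (deriv x u * deriv (deriv y) u - deriv y u * deriv (deriv x) u) /
          √((deriv x u) ^ 2 + (deriv y u) ^ 2) ^ 3)) u := by
  have smooth_deriv : ∀ {f : ℝ → ℝ}, ContDiff ℝ (⊤ : ℕ∞) f → ContDiff ℝ (⊤ : ℕ∞) (deriv f) :=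
    fun hf => (contDiff_infty_iff_deriv.1 hf).2
  have hx' := ((smooth_deriv hx).differentiable (by simp) u).hasDerivAt
  have hy' := ((smooth_deriv hy).differentiable (by simp) u).hasDerivAt
  have hy0 := (hy.differentiable (by simp) u).hasDerivAt
  have hs := ((hx'.fun_pow 2).fun_add (hy'.fun_pow 2)).sqrt hu.ne'
  have hs0 := Real.sqrt_pos.2 hu
  refine (hy0.fun_mul (hy'.fun_div hs hs0.ne')).congr_deriv ?_
  have hsq := Real.sq_sqrt hu.le
  have hne := hs0.ne'
  generalize √((deriv x u) ^ 2 + (deriv y u) ^ 2) = s at hsq hne ⊢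
  field_simp
  push_cast
  simp only [pow_one]
  linear_combination 2 * y u * deriv (deriv y) u * hsq

/-- For a smooth 1-periodic immersed curve `γ = (γ₁, γ₂)` in the hyperbolic half-plane,
the Euclidean length satisfies `L_E(γ)² ≤ μ(γ) · W(γ)`, where
`μ(γ) = 2π ∫₀¹ γ₂ |γ'|` is the area of the torus of revolution with profile curve `γ`
and `W(γ) = (π/2) ∫₀¹ (κ_euc[γ] − γ₁'/(|γ'| γ₂))² γ₂ |γ'|` is its Willmore energy, with
`κ_euc[γ] = (γ₁' γ₂'' − γ₂' γ₁'')/|γ'|³`. -/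
theorem stmt_5
    (γ₁ γ₂ : ℝ → ℝ)
    (hγ₁ : ContDiff ℝ (⊤ : ℕ∞) γ₁) (hγ₂ : ContDiff ℝ (⊤ : ℕ∞) γ₂)
    (hpos : ∀ u, 0 < γ₂ u)
    (hper₁ : ∀ u, γ₁ (u + 1) = γ₁ u) (hper₂ : ∀ u, γ₂ (u + 1) = γ₂ u)
    (himm : ∀ u, (deriv γ₁ u, deriv γ₂ u) ≠ (0, 0)) :
    (∫ u in (0:ℝ)..1, Real.sqrt ((deriv γ₁ u) ^ 2 + (deriv γ₂ u) ^ 2)) ^ 2 ≤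
      (2 * π * ∫ u in (0:ℝ)..1,
          γ₂ u * Real.sqrt ((deriv γ₁ u) ^ 2 + (deriv γ₂ u) ^ 2)) *
      (π / 2 * ∫ u in (0:ℝ)..1,
          ((deriv γ₁ u * deriv (deriv γ₂) u - deriv γ₂ u * deriv (deriv γ₁) u) /
              (Real.sqrt ((deriv γ₁ u) ^ 2 + (deriv γ₂ u) ^ 2)) ^ 3 -
            deriv γ₁ u /
              (Real.sqrt ((deriv γ₁ u) ^ 2 + (deriv γ₂ u) ^ 2) * γ₂ u)) ^ 2 *
          (γ₂ u * Real.sqrt ((deriv γ₁ u) ^ 2 + (deriv γ₂ u) ^ 2))) := by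
  have hd₁ : ContDiff ℝ (⊤ : ℕ∞) (deriv γ₁) := (contDiff_infty_iff_deriv.1 hγ₁).2
  have hd₂ : ContDiff ℝ (⊤ : ℕ∞) (deriv γ₂) := (contDiff_infty_iff_deriv.1 hγ₂).2
  have c₁ := hd₁.continuous
  have c₂ := hd₂.continuous
  have c₁' := (contDiff_infty_iff_deriv.1 hd₁).2.continuous
  have c₂' := (contDiff_infty_iff_deriv.1 hd₂).2.continuous
  have c₀ := hγ₂.continuous
  have hq : ∀ u, 0 < (deriv γ₁ u) ^ 2 + (deriv γ₂ u) ^ 2 := by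
    intro u
    have h := himm u
    rw [Ne, Prod.mk.injEq, not_and_or] at h
    rcases h with h | h <;> positivity
  have hF := fun u => hasDerivAt_mul_deriv_div_speed hγ₁ hγ₂ u (hq u)
  have hper : deriv γ₁ 1 = deriv γ₁ 0 ∧ deriv γ₂ 1 = deriv γ₂ 0 := by
    have key : ∀ f : ℝ → ℝ, (∀ u, f (u + 1) = f u) → deriv f 1 = deriv f 0 := by
      intro f hf
      have h := deriv_comp_add_const f 1 0
      rw [funext hf, zero_add] at h
      exact h.symm
    exact ⟨key _ hper₁, key _ hper₂⟩
  have hy1 : γ₂ 1 = γ₂ 0 := by simpa using hper₂ 0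
  set s : ℝ → ℝ := fun u => √((deriv γ₁ u) ^ 2 + (deriv γ₂ u) ^ 2) with hs
  have hs0 : ∀ u, 0 < s u := fun u => Real.sqrt_pos.2 (hq u)
  have hsq : ∀ u, s u ^ 2 = (deriv γ₁ u) ^ 2 + (deriv γ₂ u) ^ 2 :=
    fun u => Real.sq_sqrt (hq u).le
  have cs : Continuous s := by fun_prop
  change ∀ u, HasDerivAt (fun u => γ₂ u * (deriv γ₂ u / s u))
    (deriv γ₂ u ^ 2 / s u + γ₂ u * (deriv γ₁ u * (deriv γ₁ u * deriv (deriv γ₂) u -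
      deriv γ₂ u * deriv (deriv γ₁) u) / s u ^ 3)) u at hF
  set F' : ℝ → ℝ := fun u => deriv γ₂ u ^ 2 / s u + γ₂ u * (deriv γ₁ u *
    (deriv γ₁ u * deriv (deriv γ₂) u - deriv γ₂ u * deriv (deriv γ₁) u) / s u ^ 3) with hF'
  set H : ℝ → ℝ := fun u =>
    (deriv γ₁ u * deriv (deriv γ₂) u - deriv γ₂ u * deriv (deriv γ₁) u) / s u ^ 3 -
      deriv γ₁ u / (s u * γ₂ u) with hH
  change (∫ u in (0:ℝ)..1, s u) ^ 2 ≤ (2 * π * ∫ u in (0:ℝ)..1, γ₂ u * s u) *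
    (π / 2 * ∫ u in (0:ℝ)..1, H u ^ 2 * (γ₂ u * s u))
  have cF' : Continuous F' := by
    refine ((c₂.pow 2).div cs fun u => (hs0 u).ne').add (c₀.mul (Continuous.div ?_ (cs.pow 3)
      fun u => (pow_pos (hs0 u) 3).ne'))
    fun_prop
  have cH : Continuous H := by
    refine (Continuous.div ?_ (cs.pow 3) fun u => (pow_pos (hs0 u) 3).ne').sub
      (c₁.div (cs.mul c₀) fun u => (mul_pos (hs0 u) (hpos u)).ne')
    fun_prop
  have hint : ∫ u in (0:ℝ)..1, F' u = 0 := by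
    rw [intervalIntegral.integral_eq_sub_of_hasDerivAt (fun u _ => hF u)
      (cF'.intervalIntegrable _ _)]
    simp only [hs, hper.1, hper.2, hy1, sub_self]
  have hident : ∀ u, s u = F' u - H u * (deriv γ₁ u / s u) * (γ₂ u * s u) := by
    intro u
    have h1 := (hs0 u).ne'
    have h2 := (hpos u).ne'
    simp only [hF', hH]
    have h3 := hsq u
    generalize s u = r at *
    field_simp
    linear_combination r ^ 2 * h3
  have hbound : ∀ t u, 2 * t * s u ≤
      t ^ 2 * (H u ^ 2 * (γ₂ u * s u)) + γ₂ u * s u + 2 * t * F' u := by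
    intro t u
    have hc : (deriv γ₁ u / s u) ^ 2 ≤ 1 := by
      rw [div_pow, div_le_one (pow_pos (hs0 u) 2), hsq u]
      nlinarith [sq_nonneg (deriv γ₂ u)]
    have hw := mul_pos (hpos u) (hs0 u)
    have hmul : 0 ≤ (t ^ 2 * H u ^ 2 + 1 + 2 * t * (H u * (deriv γ₁ u / s u))) *
        (γ₂ u * s u) :=
      mul_nonneg (by nlinarith [sq_nonneg (t * H u + deriv γ₁ u / s u)]) hw.le
    linear_combination hmul + 2 * t * hident u
  have hquad : (∫ u in (0:ℝ)..1, s u) ^ 2 ≤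
      (∫ u in (0:ℝ)..1, γ₂ u * s u) * ∫ u in (0:ℝ)..1, H u ^ 2 * (γ₂ u * s u) := by
    refine sq_le_mul_of_forall_quadratic fun t => ?_
    have hA : Continuous fun u => t ^ 2 * (H u ^ 2 * (γ₂ u * s u)) := by fun_prop
    have hB : Continuous fun u => γ₂ u * s u := by fun_prop
    have hAB : Continuous fun u => t ^ 2 * (H u ^ 2 * (γ₂ u * s u)) + γ₂ u * s u := by fun_prop
    have hC : Continuous fun u => 2 * t * F' u := by fun_prop
    have h : (∫ u in (0:ℝ)..1, 2 * t * s u) ≤ ∫ u in (0:ℝ)..1,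
        (t ^ 2 * (H u ^ 2 * (γ₂ u * s u)) + γ₂ u * s u + 2 * t * F' u) :=
      intervalIntegral.integral_mono zero_le_one
        ((continuous_const.mul cs).intervalIntegrable 0 1)
        ((hAB.add hC).intervalIntegrable 0 1) (hbound t)
    rw [intervalIntegral.integral_add (hAB.intervalIntegrable 0 1)
      (hC.intervalIntegrable 0 1), intervalIntegral.integral_add (hA.intervalIntegrable 0 1)
      (hB.intervalIntegrable 0 1)] at h
    simpa only [intervalIntegral.integral_const_mul, hint, mul_zero, add_zero] using h
  have hπ : 1 ≤ π ^ 2 := by nlinarith [Real.pi_gt_three]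
  calc _ ≤ _ := hquad
    _ ≤ π ^ 2 * _ := le_mul_of_one_le_left ((sq_nonneg _).trans hquad) hπ
    _ = _ := by ring
end

section
/- Let ρ ≥ 4, set θ = arccos(1 − 8/ρ²), and let i, j be integers with 1 ≤ i, j ≤ ⌊π/(4θ)⌋ and i ≠ j. Then 2ρ²(1 − cos((i − j)θ)) ≥ 16. (Equivalently, the Euclidean distance between the points (0, ρcos(iθ), ρsin(iθ)) and (0, ρcos(jθ), ρsin(jθ)) in ℝ³ is at least 4.) -/
open Real

/-- For `ρ ≥ 4`, `θ = arccos(1 − 8/ρ²)`, and integers `1 ≤ i, j ≤ ⌊π/(4θ)⌋` with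
`i ≠ j`, one has `2ρ²(1 − cos((i − j)θ)) ≥ 16`. -/
theorem stmt_7 (ρ : ℝ) (hρ : 4 ≤ ρ) (i j : ℤ)
    (hi₁ : 1 ≤ i) (hi₂ : i ≤ ⌊π / (4 * Real.arccos (1 - 8 / ρ ^ 2))⌋)
    (hj₁ : 1 ≤ j) (hj₂ : j ≤ ⌊π / (4 * Real.arccos (1 - 8 / ρ ^ 2))⌋)
    (hij : i ≠ j) :
    16 ≤ 2 * ρ ^ 2 *
      (1 - Real.cos (((i : ℝ) - (j : ℝ)) * Real.arccos (1 - 8 / ρ ^ 2))) := by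
  have hρ2 : 16 ≤ ρ ^ 2 := by nlinarith
  have hq : 0 < 8 / ρ ^ 2 := by positivity
  have hq' : 8 / ρ ^ 2 ≤ 1 := by
    rw [div_le_one (by linarith)]
    linarith
  have hcos : Real.cos (Real.arccos (1 - 8 / ρ ^ 2)) = 1 - 8 / ρ ^ 2 :=
    Real.cos_arccos (by linarith) (by linarith)
  have hθ : 0 < Real.arccos (1 - 8 / ρ ^ 2) := Real.arccos_pos.2 (by linarith)
  generalize Real.arccos (1 - 8 / ρ ^ 2) = θ at *
  have hfloor : (⌊π / (4 * θ)⌋ : ℝ) * (4 * θ) ≤ π :=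
    (le_div_iff₀ (by positivity)).1 (Int.floor_le _)
  have hlow : (1 : ℝ) ≤ |(i : ℝ) - j| := by
    exact_mod_cast Int.one_le_abs (sub_ne_zero.2 hij)
  have hupp : |(i : ℝ) - j| ≤ ⌊π / (4 * θ)⌋ := by
    have h : |i - j| ≤ ⌊π / (4 * θ)⌋ := abs_le.2 ⟨by linarith, by linarith⟩
    exact_mod_cast h
  have hle : Real.cos (((i : ℝ) - j) * θ) ≤ Real.cos θ := by
    rw [← Real.cos_abs, abs_mul, abs_of_pos hθ]
    apply Real.cos_le_cos_of_nonneg_of_le_pi hθ.le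
    · nlinarith
    · nlinarith
  calc (16 : ℝ) = 2 * ρ ^ 2 * (8 / ρ ^ 2) := by
        field_simp
        norm_num
    _ ≤ 2 * ρ ^ 2 * (1 - Real.cos (((i : ℝ) - j) * θ)) := by
        gcongr
        linarith
end
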